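/- Let (∂ : E → G, ▷) be a crossed module of groups. Let a = (X, Y, Z, W, e_a), b = (X', Y', Y, W', e_b), c = (W, Ŷ, Z', Ŵ, e_c) and d = (W', Ŷ', Ŷ, Ŵ', e_d) be squares in 𝒢, so that a and b are horizontally composable, c and d are horizontally composable, a and c are vertically composable, and b and d are vertically composable. Then the interchange law holds: the vertical composite of (a ∘ₕ b) with (c ∘ₕ d) equals the horizontal composite of (a ∘ᵥ c) with (b ∘ᵥ d); in particular, at the level of E-components, (X ▷ e_b) e_a (Z ▷ ((W ▷ e_d) e_c)) = (X ▷ (e_b (Y ▷ e_d))) (e_a (Z ▷ e_c)). -/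

import Mathlib

/-- A square in `𝒢`, encoded as a quintuple `(X, Y, Z, W, e)` of its bottom, right, left
and top edges in `G` and its face `e ∈ E`, satisfying `δ(e)⁻¹ X Y = Z W`. -/
def IsSqT {G E : Type*} [Group G] [Group E] (δ : E →* G)
    (k : G × G × G × G × E) : Prop :=
  (δ k.2.2.2.2)⁻¹ * k.1 * k.2.1 = k.2.2.1 * k.2.2.2.1

/-- Horizontal composite of squares:
`(X, Y, Z, W, e) ∘ₕ (X', Y', Y, W', e') = (X X', Y', Z, W W', (X ▷ e') e)`. -/
def hcompSq {G E : Type*} [Group G] [Group E] (act : G →* MulAut E)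
    (a b : G × G × G × G × E) : G × G × G × G × E :=
  (a.1 * b.1, b.2.1, a.2.2.1, a.2.2.2.1 * b.2.2.2.1, act a.1 b.2.2.2.2 * a.2.2.2.2)

/-- Vertical composite of squares:
`(X, Y, Z, W, e) ∘ᵥ (W, Y', Z', W', e') = (X, Y Y', Z Z', W', e (Z ▷ e'))`. -/
def vcompSq {G E : Type*} [Group G] [Group E] (act : G →* MulAut E)
    (a b : G × G × G × G × E) : G × G × G × G × E :=
  (a.1, a.2.1 * b.2.1, a.2.2.1 * b.2.2.1, b.2.2.2.1, a.2.2.2.2 * act a.2.2.1 b.2.2.2.2)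

/-- the interchange law for squares in `𝒢`:
`(a ∘ₕ b) ∘ᵥ (c ∘ₕ d) = (a ∘ᵥ c) ∘ₕ (b ∘ᵥ d)`, where
`a = (X, Y, Z, W, ea)`, `b = (X', Y', Y, W', eb)`, `c = (W, Y₂, Z₂, W₂, ec)` and
`d = (W', Y₂', Y₂, W₂', ed)`; in particular, at the level of `E`-components,
`(X ▷ eb) ea (Z ▷ ((W ▷ ed) ec)) = (X ▷ (eb (Y ▷ ed))) (ea (Z ▷ ec))`. -/
theorem interchange_law
    {G E : Type*} [Group G] [Group E]
    (δ : E →* G) (act : G →* MulAut E)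
    (peiffer1 : ∀ (g : G) (e : E), δ (act g e) = g * δ e * g⁻¹)
    (peiffer2 : ∀ e f : E, act (δ e) f = e * f * e⁻¹)
    (X Y Z W : G) (ea : E) (X' Y' W' : G) (eb : E)
    (Y₂ Z₂ W₂ : G) (ec : E) (Y₂' W₂' : G) (ed : E)
    (ha : IsSqT δ (X, Y, Z, W, ea))
    (hb : IsSqT δ (X', Y', Y, W', eb))
    (hc : IsSqT δ (W, Y₂, Z₂, W₂, ec))
    (hd : IsSqT δ (W', Y₂', Y₂, W₂', ed)) :
    vcompSq act (hcompSq act (X, Y, Z, W, ea) (X', Y', Y, W', eb))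
        (hcompSq act (W, Y₂, Z₂, W₂, ec) (W', Y₂', Y₂, W₂', ed)) =
      hcompSq act (vcompSq act (X, Y, Z, W, ea) (W, Y₂, Z₂, W₂, ec))
        (vcompSq act (X', Y', Y, W', eb) (W', Y₂', Y₂, W₂', ed)) ∧
    act X eb * ea * act Z (act W ed * ec) =
      act X (eb * act Y ed) * (ea * act Z ec) := by
  have slide : ea * act Z (act W ed) = act X (act Y ed) * ea := by
    have edges : Z * W = δ ea⁻¹ * (X * Y) := by
      rw [map_inv, ← mul_assoc]
      exact ha.symm
    rw [← MulAut.mul_apply, ← map_mul, edges, map_mul act, MulAut.mul_apply, peiffer2,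
      map_mul act, MulAut.mul_apply]
    group
  have faces : act X eb * ea * act Z (act W ed * ec) =
      act X (eb * act Y ed) * (ea * act Z ec) := by
    rw [map_mul, map_mul]
    calc
      _ = act X eb * (ea * act Z (act W ed)) * act Z ec := by group
      _ = _ := by
        rw [slide]
        group
  exact ⟨by simpa only [vcompSq, hcompSq, Prod.mk.injEq, true_and] using faces, faces⟩
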